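/- Suppose the smooth functions Ψ⁽⁺²⁾, Ψ⁽⁻²⁾, F⁽⁺²⁾, F⁽⁻²⁾ on Ω satisfy the inhomogeneous Regge–Wheeler equations 𝕽⁽±²⁾Ψ⁽±²⁾ = F⁽±²⁾. Define the reverse Chandrasekhar transformations ψ⁽⁺²ʳ⁾ = w⁻¹LΨ⁽⁺²⁾, α̃⁽⁺²ʳ⁾ = w²(𝓛⁽⁺²⁾(𝓛⁽⁺²⁾−2)+12M∂ₜ)( w⁻¹Lψ⁽⁺²ʳ⁾ ), ψ⁽⁻²ʳ⁾ = w⁻¹L̲Ψ⁽⁻²⁾, α̃⁽⁻²ʳ⁾ = w²(𝓛⁽⁻²⁾(𝓛⁽⁻²⁾−2)−12M∂ₜ)( w⁻¹L̲ψ⁽⁻²ʳ⁾ ). Then on Ω: 𝔗⁽⁺²⁾α̃⁽⁺²ʳ⁾ = (𝓛⁽⁺²⁾(𝓛⁽⁺²⁾−2)+12M∂ₜ)( L(w L(w⁻¹F⁽⁺²⁾)) − 2w′ L(w⁻¹F⁽⁺²⁾) ) and 𝔗⁽⁻²⁾α̃⁽⁻²ʳ⁾ = (𝓛⁽⁻²⁾(𝓛⁽⁻²⁾−2)−12M∂ₜ)(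 L̲(w L̲(w⁻¹F⁽⁻²⁾)) + 2w′ L̲(w⁻¹F⁽⁻²⁾) ). In particular, if F⁽±²⁾ = 0 then 𝔗⁽±²⁾α̃⁽±²ʳ⁾ = 0. -/

import Mathlib

/- Schwarzschild-Anti-de Sitter background: basic operators on functions
   u(t, r, ϑ, φ) with values in ℂ. -/

noncomputable section

open Filter Topology Set

namespace Grav

abbrev F4 : Type := ℝ → ℝ → ℝ → ℝ → ℂ

/-- `Δ(r) = r² + k²r⁴ − 2Mr`. -/
def Del (M k r : ℝ) : ℝ := r ^ 2 + k ^ 2 * r ^ 4 - 2 * M * r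

/-- `∂ₜ`. -/
def dT (u : F4) : F4 := fun t r ϑ φ => deriv (fun s => u s r ϑ φ) t
/-- `∂ᵣ`. -/
def dR (u : F4) : F4 := fun t r ϑ φ => deriv (fun s => u t s ϑ φ) r
/-- `∂_ϑ`. -/
def dTh (u : F4) : F4 := fun t r ϑ φ => deriv (fun s => u t r s φ) ϑ
/-- `∂_φ`. -/
def dPh (u : F4) : F4 := fun t r ϑ φ => deriv (fun s => u t r ϑ s) φ

/-- `L u = ∂ₜ u + (Δ/r²) ∂ᵣ u`. -/
def opL (M k : ℝ) (u : F4) : F4 := fun t r ϑ φ =>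
  dT u t r ϑ φ + ((Del M k r / r ^ 2 : ℝ) : ℂ) * dR u t r ϑ φ

/-- `L̲ u = ∂ₜ u − (Δ/r²) ∂ᵣ u`. -/
def opLb (M k : ℝ) (u : F4) : F4 := fun t r ϑ φ =>
  dT u t r ϑ φ - ((Del M k r / r ^ 2 : ℝ) : ℂ) * dR u t r ϑ φ

/-- `w = Δ/r⁴`. -/
def ww (M k r : ℝ) : ℝ := Del M k r / r ^ 4
/-- `w′ = w·(6M − 2r)/r²`. -/
def wwP (M k r : ℝ) : ℝ := ww M k r * (6 * M - 2 * r) / r ^ 2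

/-- The angular operator `𝓛⁽⁺²⁾`. -/
def angP (u : F4) : F4 := fun t r ϑ φ =>
  -(Real.sin ϑ : ℂ)⁻¹ * deriv (fun x => (Real.sin x : ℂ) * dTh u t r x φ) ϑ
  - (((Real.sin ϑ) ^ 2 : ℝ) : ℂ)⁻¹ * dPh (dPh u) t r ϑ φ
  - 4 * Complex.I * ((Real.cos ϑ / (Real.sin ϑ) ^ 2 : ℝ) : ℂ) * dPh u t r ϑ φ
  + 4 * (((Real.cos ϑ / Real.sin ϑ) ^ 2 : ℝ) : ℂ) * u t r ϑ φ
  + 4 * u t r ϑ φ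

/-- The angular operator `𝓛⁽⁻²⁾`. -/
def angM (u : F4) : F4 := fun t r ϑ φ =>
  -(Real.sin ϑ : ℂ)⁻¹ * deriv (fun x => (Real.sin x : ℂ) * dTh u t r x φ) ϑ
  - (((Real.sin ϑ) ^ 2 : ℝ) : ℂ)⁻¹ * dPh (dPh u) t r ϑ φ
  + 4 * Complex.I * ((Real.cos ϑ / (Real.sin ϑ) ^ 2 : ℝ) : ℂ) * dPh u t r ϑ φ
  + 4 * (((Real.cos ϑ / Real.sin ϑ) ^ 2 : ℝ) : ℂ) * u t r ϑ φ
  + 4 * u t r ϑ φ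

/-- The Teukolsky operator `𝔗⁽⁺²⁾u = −LL̲u + 2(w′/w)L̲u − w(𝓛⁽⁺²⁾ − 2 + 6M/r)u`. -/
def Tp (M k : ℝ) (u : F4) : F4 := fun t r ϑ φ =>
  - opL M k (opLb M k u) t r ϑ φ
  + 2 * ((wwP M k r / ww M k r : ℝ) : ℂ) * opLb M k u t r ϑ φ
  - ((ww M k r : ℝ) : ℂ) *
      (angP u t r ϑ φ - 2 * u t r ϑ φ + ((6 * M / r : ℝ) : ℂ) * u t r ϑ φ)

/-- The Teukolsky operator `𝔗⁽⁻²⁾u = −LL̲u − 2(w′/w)Lu − w(𝓛⁽⁻²⁾ − 2 + 6M/r)u`. -/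
def Tm (M k : ℝ) (u : F4) : F4 := fun t r ϑ φ =>
  - opL M k (opLb M k u) t r ϑ φ
  - 2 * ((wwP M k r / ww M k r : ℝ) : ℂ) * opL M k u t r ϑ φ
  - ((ww M k r : ℝ) : ℂ) *
      (angM u t r ϑ φ - 2 * u t r ϑ φ + ((6 * M / r : ℝ) : ℂ) * u t r ϑ φ)

/-- The Regge–Wheeler operator `𝕽⁽⁺²⁾u = −LL̲u − w(𝓛⁽⁺²⁾ − 6M/r)u`. -/
def RWp (M k : ℝ) (u : F4) : F4 := fun t r ϑ φ =>
  - opL M k (opLb M k u) t r ϑ φ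
  - ((ww M k r : ℝ) : ℂ) * (angP u t r ϑ φ - ((6 * M / r : ℝ) : ℂ) * u t r ϑ φ)

/-- The Regge–Wheeler operator `𝕽⁽⁻²⁾u = −LL̲u − w(𝓛⁽⁻²⁾ − 6M/r)u`. -/
def RWm (M k : ℝ) (u : F4) : F4 := fun t r ϑ φ =>
  - opL M k (opLb M k u) t r ϑ φ
  - ((ww M k r : ℝ) : ℂ) * (angM u t r ϑ φ - ((6 * M / r : ℝ) : ℂ) * u t r ϑ φ)

/-- The exterior region `Ω = {r > r₊, 0 < ϑ < π}` (as a subset of ℝ⁴). -/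
def OmSet (rp : ℝ) : Set (ℝ × ℝ × ℝ × ℝ) :=
  {p | rp < p.2.1 ∧ 0 < p.2.2.1 ∧ p.2.2.1 < Real.pi}

/-- `u` is smooth on `Ω`. -/
def SmoothOnOm (rp : ℝ) (u : F4) : Prop :=
  ContDiffOn ℝ (⊤ : ℕ∞)
    (fun p : ℝ × ℝ × ℝ × ℝ => u p.1 p.2.1 p.2.2.1 p.2.2.2) (OmSet rp)

/-- Multiplication by `w⁻¹`. -/
def winv (M k : ℝ) (u : F4) : F4 := fun t r ϑ φ => ((ww M k r : ℝ) : ℂ)⁻¹ * u t r ϑ φ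
/-- Multiplication by `w`. -/
def wmul (M k : ℝ) (u : F4) : F4 := fun t r ϑ φ => ((ww M k r : ℝ) : ℂ) * u t r ϑ φ
/-- Pointwise complex conjugation. -/
def conjF (u : F4) : F4 := fun t r ϑ φ => (starRingEnd ℂ) (u t r ϑ φ)

/-- `𝓛⁽⁺²⁾(𝓛⁽⁺²⁾ − 2)`. -/
def angSqP (u : F4) : F4 := angP (fun t r ϑ φ => angP u t r ϑ φ - 2 * u t r ϑ φ)
/-- `𝓛⁽⁻²⁾(𝓛⁽⁻²⁾ − 2)`. -/
def angSqM (u : F4) : F4 := angM (fun t r ϑ φ => angM u t r ϑ φ - 2 * u t r ϑ φ)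

/-- `𝓛⁽⁺²⁾(𝓛⁽⁺²⁾ − 2) + 12M∂ₜ`. -/
def TSp (M : ℝ) (u : F4) : F4 := fun t r ϑ φ =>
  angSqP u t r ϑ φ + 12 * (M : ℂ) * dT u t r ϑ φ
/-- `𝓛⁽⁻²⁾(𝓛⁽⁻²⁾ − 2) − 12M∂ₜ`. -/
def TSm (M : ℝ) (u : F4) : F4 := fun t r ϑ φ =>
  angSqM u t r ϑ φ - 12 * (M : ℂ) * dT u t r ϑ φ

/-- Operator form of the reverse Chandrasekhar transformation, in a ring of operators in which
`T` plays the role of `∂ₜ`, `X` of `(Δ/r²)∂ᵣ`, `h` of `w′/w`, `q` of `6M/r`, `A` of `𝓛`. -/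
theorem teukolsky_reggeWheeler_identity {R : Type*} [Ring R] {T X w wi h q c A S : R}
    (hw : w * wi = 1) (hw' : wi * w = 1)
    (hhw : Commute h w) (hqw : Commute q w) (hqh : Commute q h)
    (hcw : Commute c w) (hXc : Commute X c) (hTc : Commute T c)
    (hTw : Commute T w) (hTh : Commute T h) (hTq : Commute T q) (hTX : Commute X T)
    (hXw : X * w = w * X + w * h) (hXh : X * h = h * X + w * (2 - 2 * q))
    (hXq : X * q = q * X - c * w)
    (hAT : Commute A T) (hAX : Commute A X) (hAw : Commute A w) (hAh : Commute A h)
    (hST : Commute S T) (hSX : Commute S X) (hSw : Commute S w) (hSh : Commute S h)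
    (hSq : Commute S q) (hSA : Commute S A) :
    (-((T + X) * (T - X)) + 2 * h * (T - X) - w * (A - 2 + q)) *
        (w * w * (S * (wi * ((T + X) * (wi * (T + X)))))) =
      S * (((T + X) * (w * ((T + X) * wi)) - 2 * (w * h) * ((T + X) * wi)) *
        (-((T + X) * (T - X)) - w * (A - q))) := by
  have two : (2 : R) = 1 + 1 := one_add_one_eq_two.symm
  have h2 : Commute S 2 := Commute.ofNat_right S 2
  have hLL : Commute (T - X) (T + X) :=
    ((Commute.refl T).sub_left hTX).add_right (hTX.symm.sub_left (Commute.refl X))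
  have hLc : Commute (T + X) c := hTc.add_left hXc
  have hAL : Commute A (T + X) := hAT.add_right hAX
  have hALb : Commute A (T - X) := hAT.sub_right hAX
  have hSL : Commute S (T + X) := hST.add_right hSX
  have hSLb : Commute S (T - X) := hST.sub_right hSX
  have hLw : (T + X) * w = w * (T + X) + w * h := by
    rw [add_mul, hXw, hTw.eq, mul_add]; abel
  have hLbw : (T - X) * w = w * (T - X) - w * h := by
    rw [sub_mul, hXw, hTw.eq, mul_sub]; abel
  have hLh : (T + X) * h = h * (T + X) + (w + w - (w * q + w * q)) := by
    rw [add_mul, hXh, hTh.eq, two]; noncomm_ring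
  have hLbh : (T - X) * h = h * (T - X) - (w + w - (w * q + w * q)) := by
    rw [sub_mul, hXh, hTh.eq, two]; noncomm_ring
  have hLq : (T + X) * q = q * (T + X) - c * w := by
    rw [add_mul, hXq, hTq.eq, mul_add]; abel
  generalize T + X = L at *
  generalize T - X = Lb at *
  have inv {x : R} (hx : Commute x w) : Commute x wi :=
    Commute.units_inv_right (u := ⟨w, wi, hw, hw'⟩) hx
  have inv_rule {Y g : R} (hY : Y * w = w * Y + w * g) (hg : Commute g w) :
      Y * wi = wi * Y - wi * g := by
    have h1 : wi * (Y * w) * wi = wi * (w * Y + w * g) * wi := by rw [hY]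
    rw [mul_assoc, mul_assoc, hw, mul_one, mul_add, ← mul_assoc, ← mul_assoc, hw', one_mul,
      one_mul, add_mul, (inv hg).eq] at h1
    rw [h1]; abel
  have hLwi : L * wi = wi * L - wi * h := inv_rule hLw hhw
  have hLbwi : Lb * wi = wi * Lb + wi * h := by
    have := inv_rule (Y := Lb) (g := -h) (by rw [hLbw]; noncomm_ring) hhw.neg_left
    rw [this]; noncomm_ring
  have hhwi := inv hhw
  have hqwi := inv hqw
  have hAwi := inv hAw
  have hS : Commute S ((-(L * Lb) + 2 * h * Lb - w * (A - 2 + q)) * (w * w)) :=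
    (((hSL.mul_right hSLb).neg_right.add_right ((h2.mul_right hSh).mul_right hSLb)).sub_right
      (hSw.mul_right ((hSA.sub_right h2).add_right hSq))).mul_right (hSw.mul_right hSw)
  have assoc {a b e : R} (hab : a * b = e) (x : R) : a * (b * x) = e * x := by
    rw [← hab, mul_assoc]
  rw [← mul_assoc, ← mul_assoc, ← hS.eq, mul_assoc]
  congr 1
  simp only [two, mul_add, add_mul, mul_sub, sub_mul, neg_mul, mul_neg, mul_assoc, one_mul,
    mul_one, assoc hw, assoc hw', hhw.eq, assoc hhw.eq, hqw.eq, assoc hqw.eq,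
    assoc hqh.eq, assoc hhwi.eq, assoc hqwi.eq, hcw.eq,
    hLc.eq, hLL.eq, assoc hLL.eq, assoc hLw, assoc hLbw, hLh, assoc hLh,
    assoc hLbh, hLq, assoc hLq, hLwi, assoc hLwi, assoc hLbwi,
    hAL.eq, assoc hAL.eq, hAw.eq, assoc hAw.eq, assoc hAh.eq, assoc hAwi.eq]
  abel

/-- Coordinates `(t, r, ϑ, φ)`. -/
abbrev E4 : Type := ℝ × ℝ × ℝ × ℝ

theorem isOpen_OmSet (rp : ℝ) : IsOpen (OmSet rp) := by
  have h₁ : IsOpen {p : E4 | rp < p.2.1} := isOpen_lt continuous_const (by fun_prop)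
  have h₂ : IsOpen {p : E4 | 0 < p.2.2.1} := isOpen_lt continuous_const (by fun_prop)
  have h₃ : IsOpen {p : E4 | p.2.2.1 < Real.pi} := isOpen_lt (by fun_prop) continuous_const
  exact h₁.inter (h₂.inter h₃)

/-- The submodule of functions smooth on `Ω` and vanishing outside `Ω`. -/
def smoothSubmodule (rp : ℝ) : Submodule ℂ (E4 → ℂ) where
  carrier := {v | ContDiffOn ℝ (⊤ : ℕ∞) v (OmSet rp) ∧ ∀ p ∉ OmSet rp, v p = 0}
  add_mem' := fun ha hb => ⟨ha.1.add hb.1, fun p hp => by simp [ha.2 p hp, hb.2 p hp]⟩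
  zero_mem' := ⟨contDiffOn_const, fun _ _ => rfl⟩
  smul_mem' := fun c _ ha => ⟨ha.1.const_smul c, fun p hp => by simp [ha.2 p hp]⟩

/-- Functions smooth on `Ω`, normalized to vanish outside `Ω`. -/
def SmoothFun (rp : ℝ) : Type := smoothSubmodule rp

instance (rp : ℝ) : AddCommGroup (SmoothFun rp) :=
  inferInstanceAs (AddCommGroup (smoothSubmodule rp))

instance (rp : ℝ) : Module ℂ (SmoothFun rp) :=
  inferInstanceAs (Module ℂ (smoothSubmodule rp))

variable {rp : ℝ}

@[simp]
theorem SmoothFun.zero_val (p : E4) : (0 : SmoothFun rp).1 p = 0 := rfl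

@[simp]
theorem SmoothFun.add_val (u v : SmoothFun rp) (p : E4) : (u + v).1 p = u.1 p + v.1 p := rfl

@[simp]
theorem SmoothFun.sub_val (u v : SmoothFun rp) (p : E4) : (u - v).1 p = u.1 p - v.1 p := rfl

@[simp]
theorem SmoothFun.neg_val (u : SmoothFun rp) (p : E4) : (-u).1 p = -u.1 p := rfl

@[simp]
theorem SmoothFun.smul_val (c : ℂ) (u : SmoothFun rp) (p : E4) : (c • u).1 p = c * u.1 p := rfl

theorem SmoothFun.add_val_eq (u v : SmoothFun rp) : (u + v).1 = u.1 + v.1 := rfl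

theorem SmoothFun.smul_val_eq (c : ℂ) (u : SmoothFun rp) : (c • u).1 = c • u.1 := rfl

theorem SmoothFun.ext {u v : SmoothFun rp} (h : ∀ p ∈ OmSet rp, u.1 p = v.1 p) : u = v := by
  refine Subtype.ext (funext fun p => ?_)
  by_cases hp : p ∈ OmSet rp
  · exact h p hp
  · rw [u.2.2 p hp, v.2.2 p hp]

theorem SmoothFun.contDiffAt (v : SmoothFun rp) {p : E4} (hp : p ∈ OmSet rp) :
    ContDiffAt ℝ (⊤ : ℕ∞) v.1 p :=
  v.2.1.contDiffAt ((isOpen_OmSet rp).mem_nhds hp)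

theorem SmoothFun.differentiableAt (v : SmoothFun rp) {p : E4} (hp : p ∈ OmSet rp) :
    DifferentiableAt ℝ v.1 p :=
  (SmoothFun.contDiffAt v hp).differentiableAt (by simp)

/-- The element of `SmoothFun rp` agreeing on `Ω` with a function smooth on `Ω`. -/
def SmoothFun.restrict (v : E4 → ℂ) (hv : ContDiffOn ℝ (⊤ : ℕ∞) v (OmSet rp)) : SmoothFun rp :=
  ⟨(OmSet rp).indicator v, hv.congr fun _ hp => indicator_of_mem hp v,
    fun _ hp => indicator_of_notMem hp v⟩

theorem SmoothFun.restrict_apply {v : E4 → ℂ} (hv : ContDiffOn ℝ (⊤ : ℕ∞) v (OmSet rp))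
    {p : E4} (hp : p ∈ OmSet rp) : (SmoothFun.restrict v hv).1 p = v p :=
  indicator_of_mem hp v

theorem SmoothFun.contDiffOn_fderiv_apply (v : SmoothFun rp) (e : E4) :
    ContDiffOn ℝ (⊤ : ℕ∞) (fun p => fderiv ℝ v.1 p e) (OmSet rp) :=
  (v.2.1.fderiv_of_isOpen (isOpen_OmSet rp) (by simp)).clm_apply contDiffOn_const

/-- Differentiation in the direction `e`. -/
def pd (e : E4) : Module.End ℂ (SmoothFun rp) where
  toFun v := SmoothFun.restrict _ (SmoothFun.contDiffOn_fderiv_apply v e)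
  map_add' u v := SmoothFun.ext fun p hp => by
    have := fderiv_add (SmoothFun.differentiableAt u hp) (SmoothFun.differentiableAt v hp)
    simp [SmoothFun.restrict_apply _ hp, SmoothFun.add_val_eq, this]
  map_smul' c v := SmoothFun.ext fun p hp => by
    have := fderiv_const_smul (SmoothFun.differentiableAt v hp) c
    simp [SmoothFun.restrict_apply _ hp, SmoothFun.smul_val_eq, this]

theorem pd_apply (e : E4) (v : SmoothFun rp) {p : E4} (hp : p ∈ OmSet rp) :
    (pd e v).1 p = fderiv ℝ v.1 p e :=
  SmoothFun.restrict_apply (SmoothFun.contDiffOn_fderiv_apply v e) hp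

theorem pd_commute (e e' : E4) : Commute (pd (rp := rp) e) (pd e') := by
  refine LinearMap.ext fun v => SmoothFun.ext fun p hp => ?_
  have key (a b : E4) : (pd a (pd b v)).1 p = fderiv ℝ (fderiv ℝ v.1) p a b := by
    have h : (pd b v).1 =ᶠ[𝓝 p] fun x => fderiv ℝ v.1 x b :=
      eventually_of_mem ((isOpen_OmSet rp).mem_nhds hp) fun x hx => pd_apply b v hx
    have hd : DifferentiableAt ℝ (fderiv ℝ v.1) p :=
      ((v.2.1.fderiv_of_isOpen (isOpen_OmSet rp) (m := (⊤ : ℕ∞)) (by simp)).contDiffAt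
        ((isOpen_OmSet rp).mem_nhds hp)).differentiableAt (by simp)
    rw [pd_apply a _ hp, h.fderiv_eq, fderiv_clm_apply hd (differentiableAt_const b)]
    simp
  simp only [Module.End.mul_apply, key]
  exact (SmoothFun.contDiffAt v hp).isSymmSndFDerivAt
    (by rw [minSmoothness_of_isRCLikeNormedField]; exact WithTop.coe_le_coe.2 le_top) e e'

/-- Multiplication by a real function smooth on `Ω`. -/
def mulOp (m : E4 → ℝ) (hm : ContDiffOn ℝ (⊤ : ℕ∞) m (OmSet rp)) :
    Module.End ℂ (SmoothFun rp) where
  toFun v := ⟨fun p => (m p : ℂ) * v.1 p, (Complex.ofRealCLM.contDiff.comp_contDiffOn hm).mul v.2.1,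
    fun p hp => by simp [v.2.2 p hp]⟩
  map_add' u v := Subtype.ext (funext fun _ => mul_add _ _ _)
  map_smul' _ _ := Subtype.ext (funext fun _ => mul_left_comm _ _ _)

theorem mulOp_apply (m : E4 → ℝ) (hm : ContDiffOn ℝ (⊤ : ℕ∞) m (OmSet rp)) (v : SmoothFun rp)
    (p : E4) : (mulOp m hm v).1 p = (m p : ℂ) * v.1 p := rfl

theorem mulOp_commute {m n : E4 → ℝ} (hm : ContDiffOn ℝ (⊤ : ℕ∞) m (OmSet rp))
    (hn : ContDiffOn ℝ (⊤ : ℕ∞) n (OmSet rp)) : Commute (mulOp m hm) (mulOp n hn) :=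
  LinearMap.ext fun v => Subtype.ext (funext fun p => by
    simp [mulOp_apply, mul_left_comm])

theorem pd_mulOp_apply (e : E4) {m : E4 → ℝ} (hm : ContDiffOn ℝ (⊤ : ℕ∞) m (OmSet rp))
    (v : SmoothFun rp) {p : E4} (hp : p ∈ OmSet rp) :
    (pd e (mulOp m hm v)).1 p = (m p : ℂ) * (pd e v).1 p + (fderiv ℝ m p e : ℂ) * v.1 p := by
  have hd : DifferentiableAt ℝ m p :=
    (hm.contDiffAt ((isOpen_OmSet rp).mem_nhds hp)).differentiableAt (by simp)
  have h := ((Complex.ofRealCLM.hasFDerivAt.comp p hd.hasFDerivAt).mul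
    (SmoothFun.differentiableAt v hp).hasFDerivAt).fderiv
  rw [pd_apply _ _ hp, pd_apply _ _ hp]
  refine (congrArg (fun l : E4 →L[ℝ] ℂ => l e) h).trans ?_
  simp [mul_comm]

/-- Multiplication by a function of `r`. -/
def radOp (f : ℝ → ℝ) (hf : ContDiffOn ℝ (⊤ : ℕ∞) f (Ioi rp)) : Module.End ℂ (SmoothFun rp) :=
  mulOp (fun p => f p.2.1) (hf.comp (by fun_prop) fun _ hp => hp.1)

/-- Multiplication by a function of `ϑ`. -/
def angOp (g : ℝ → ℝ) (hg : ContDiffOn ℝ (⊤ : ℕ∞) g (Ioo 0 Real.pi)) :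
    Module.End ℂ (SmoothFun rp) :=
  mulOp (fun p => g p.2.2.1) (hg.comp (by fun_prop) fun _ hp => hp.2)

theorem radOp_apply (f : ℝ → ℝ) (hf : ContDiffOn ℝ (⊤ : ℕ∞) f (Ioi rp)) (v : SmoothFun rp)
    (p : E4) : (radOp f hf v).1 p = (f p.2.1 : ℂ) * v.1 p := rfl

theorem angOp_apply (g : ℝ → ℝ) (hg : ContDiffOn ℝ (⊤ : ℕ∞) g (Ioo 0 Real.pi)) (v : SmoothFun rp)
    (p : E4) : (angOp g hg v).1 p = (g p.2.2.1 : ℂ) * v.1 p := rfl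

theorem pd_radOp_apply (e : E4) {f : ℝ → ℝ} (hf : ContDiffOn ℝ (⊤ : ℕ∞) f (Ioi rp))
    (v : SmoothFun rp) {p : E4} (hp : p ∈ OmSet rp) :
    (pd e (radOp f hf v)).1 p =
      (f p.2.1 : ℂ) * (pd e v).1 p + ((e.2.1 * deriv f p.2.1 : ℝ) : ℂ) * v.1 p := by
  have hd : DifferentiableAt ℝ f p.2.1 :=
    (hf.contDiffAt (Ioi_mem_nhds hp.1)).differentiableAt (by simp)
  have h : HasFDerivAt (fun p : E4 => f p.2.1) _ p :=
    hd.hasDerivAt.comp_hasFDerivAt p (f := fun p : E4 => p.2.1)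
      ((ContinuousLinearMap.fst ℝ ℝ (ℝ × ℝ)).comp
        (ContinuousLinearMap.snd ℝ ℝ (ℝ × ℝ × ℝ))).hasFDerivAt
  rw [radOp, pd_mulOp_apply _ _ _ hp, h.fderiv]
  simp [mul_comm]

theorem pd_angOp_apply (e : E4) {g : ℝ → ℝ} (hg : ContDiffOn ℝ (⊤ : ℕ∞) g (Ioo 0 Real.pi))
    (v : SmoothFun rp) {p : E4} (hp : p ∈ OmSet rp) :
    (pd e (angOp g hg v)).1 p =
      (g p.2.2.1 : ℂ) * (pd e v).1 p + ((e.2.2.1 * deriv g p.2.2.1 : ℝ) : ℂ) * v.1 p := by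
  have hd : DifferentiableAt ℝ g p.2.2.1 :=
    (hg.contDiffAt (Ioo_mem_nhds hp.2.1 hp.2.2)).differentiableAt (by simp)
  have h : HasFDerivAt (fun p : E4 => g p.2.2.1) _ p :=
    hd.hasDerivAt.comp_hasFDerivAt p (f := fun p : E4 => p.2.2.1)
      ((ContinuousLinearMap.fst ℝ ℝ ℝ).comp ((ContinuousLinearMap.snd ℝ ℝ (ℝ × ℝ)).comp
        (ContinuousLinearMap.snd ℝ ℝ (ℝ × ℝ × ℝ)))).hasFDerivAt
  rw [angOp, pd_mulOp_apply _ _ _ hp, h.fderiv]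
  simp [mul_comm]

theorem pd_radOp_commute {e : E4} (he : e.2.1 = 0) {f : ℝ → ℝ}
    (hf : ContDiffOn ℝ (⊤ : ℕ∞) f (Ioi rp)) : Commute (pd e) (radOp f hf) :=
  LinearMap.ext fun v => SmoothFun.ext fun p hp => by
    simp [pd_radOp_apply _ _ _ hp, radOp_apply, he]

theorem radOp_commute {f g : ℝ → ℝ} (hf : ContDiffOn ℝ (⊤ : ℕ∞) f (Ioi rp))
    (hg : ContDiffOn ℝ (⊤ : ℕ∞) g (Ioi rp)) : Commute (radOp f hf) (radOp g hg) :=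
  mulOp_commute _ _

theorem pd_angOp_commute {e : E4} (he : e.2.2.1 = 0) {g : ℝ → ℝ}
    (hg : ContDiffOn ℝ (⊤ : ℕ∞) g (Ioo 0 Real.pi)) :
    Commute (pd (rp := rp) e) (angOp g hg) :=
  LinearMap.ext fun v => SmoothFun.ext fun p hp => by
    simp [pd_angOp_apply _ _ _ hp, angOp_apply, he]

/-- `u` agrees on `Ω` with `v`. -/
def Rep (u : F4) (v : SmoothFun rp) : Prop :=
  ∀ t r ϑ φ, (t, r, ϑ, φ) ∈ OmSet rp → u t r ϑ φ = v.1 (t, r, ϑ, φ)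

theorem exists_rep {u : F4} (hu : SmoothOnOm rp u) : ∃ v : SmoothFun rp, Rep u v :=
  ⟨SmoothFun.restrict _ hu, fun _ _ _ _ hp => (SmoothFun.restrict_apply hu hp).symm⟩

theorem Rep.unique {u u' : F4} {v v' : SmoothFun rp} (h : Rep u v) (h' : Rep u' v')
    (huu : ∀ t r ϑ φ, (t, r, ϑ, φ) ∈ OmSet rp → u t r ϑ φ = u' t r ϑ φ) : v = v' :=
  SmoothFun.ext fun ⟨t, r, ϑ, φ⟩ hp => by
    rw [← h t r ϑ φ hp, ← h' t r ϑ φ hp, huu t r ϑ φ hp]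

theorem deriv_comp_eq_pd {g : ℝ → ℂ} {v : SmoothFun rp} {γ : ℝ → E4} {e : E4} {s : ℝ}
    (hγ : HasDerivAt γ e s) (hs : γ s ∈ OmSet rp) (hg : ∀ x, γ x ∈ OmSet rp → g x = v.1 (γ x)) :
    deriv g s = (pd e v).1 (γ s) := by
  have h : g =ᶠ[𝓝 s] v.1 ∘ γ :=
    (hγ.continuousAt.eventually ((isOpen_OmSet rp).mem_nhds hs)).mono fun x hx => hg x hx
  rw [h.deriv_eq, pd_apply _ _ hs]
  exact ((SmoothFun.differentiableAt v hs).hasFDerivAt.comp_hasDerivAt s hγ).deriv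

theorem Rep.dT {u : F4} {v : SmoothFun rp} (h : Rep u v) : Rep (dT u) (pd (1, 0, 0, 0) v) :=
  fun t r ϑ φ hp => deriv_comp_eq_pd (γ := fun s => (s, r, ϑ, φ))
    ((hasDerivAt_id t).prodMk (hasDerivAt_const t (r, ϑ, φ))) hp fun x => h x r ϑ φ

theorem Rep.dR {u : F4} {v : SmoothFun rp} (h : Rep u v) : Rep (dR u) (pd (0, 1, 0, 0) v) :=
  fun t r ϑ φ hp => deriv_comp_eq_pd (γ := fun s => (t, s, ϑ, φ))
    ((hasDerivAt_const r t).prodMk ((hasDerivAt_id r).prodMk (hasDerivAt_const r (ϑ, φ)))) hp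
    fun x => h t x ϑ φ

theorem Rep.dTh {u : F4} {v : SmoothFun rp} (h : Rep u v) : Rep (dTh u) (pd (0, 0, 1, 0) v) :=
  fun t r ϑ φ hp => deriv_comp_eq_pd (γ := fun s => (t, r, s, φ))
    ((hasDerivAt_const ϑ t).prodMk ((hasDerivAt_const ϑ r).prodMk
      ((hasDerivAt_id ϑ).prodMk (hasDerivAt_const ϑ φ)))) hp
    fun x => h t r x φ

theorem Rep.dPh {u : F4} {v : SmoothFun rp} (h : Rep u v) : Rep (dPh u) (pd (0, 0, 0, 1) v) :=
  fun t r ϑ φ hp => deriv_comp_eq_pd (γ := fun s => (t, r, ϑ, s))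
    ((hasDerivAt_const φ t).prodMk ((hasDerivAt_const φ r).prodMk
      ((hasDerivAt_const φ ϑ).prodMk (hasDerivAt_id φ)))) hp
    fun x => h t r ϑ x

theorem sin_ne_zero_of_mem {ϑ : ℝ} (h : ϑ ∈ Ioo 0 Real.pi) : Real.sin ϑ ≠ 0 :=
  (Real.sin_pos_of_mem_Ioo h).ne'

/-- The angular operator `𝓛` on `SmoothFun rp`; `ε = 1` gives `𝓛⁽⁺²⁾` and `ε = -1` gives `𝓛⁽⁻²⁾`. -/
def angL (ε : ℂ) : Module.End ℂ (SmoothFun rp) :=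
  -(angOp (fun ϑ => (Real.sin ϑ)⁻¹) (Real.contDiff_sin.contDiffOn.inv fun _ => sin_ne_zero_of_mem) *
      (pd (0, 0, 1, 0) * (angOp Real.sin Real.contDiff_sin.contDiffOn * pd (0, 0, 1, 0))))
  - angOp (fun ϑ => (Real.sin ϑ ^ 2)⁻¹) ((Real.contDiff_sin.contDiffOn.pow 2).inv
      fun _ h => pow_ne_zero 2 (sin_ne_zero_of_mem h)) * (pd (0, 0, 0, 1) * pd (0, 0, 0, 1))
  - (ε * (4 * Complex.I)) • (angOp (fun ϑ => Real.cos ϑ / Real.sin ϑ ^ 2)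
      (Real.contDiff_cos.contDiffOn.div (Real.contDiff_sin.contDiffOn.pow 2)
        fun _ h => pow_ne_zero 2 (sin_ne_zero_of_mem h)) * pd (0, 0, 0, 1))
  + (4 : ℂ) • angOp (fun ϑ => (Real.cos ϑ / Real.sin ϑ) ^ 2)
      ((Real.contDiff_cos.contDiffOn.div Real.contDiff_sin.contDiffOn
        fun _ => sin_ne_zero_of_mem).pow 2)
  + (4 : ℂ) • 1

theorem angL_commute {ε : ℂ} {B : Module.End ℂ (SmoothFun rp)}
    (h₁ : Commute (pd (0, 0, 1, 0)) B) (h₂ : Commute (pd (0, 0, 0, 1)) B)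
    (h : ∀ g hg, Commute (angOp g hg) B) : Commute (angL ε) B :=
  ((((((h _ _).mul_left (h₁.mul_left ((h _ _).mul_left h₁))).neg_left).sub_left
    ((h _ _).mul_left (h₂.mul_left h₂))).sub_left
    (((h _ _).mul_left h₂).smul_left _)).add_left ((h _ _).smul_left _)).add_left
    ((Commute.one_left B).smul_left _)

theorem angL_commute_pd {ε : ℂ} {e : E4} (he : e.2.2.1 = 0) :
    Commute (angL (rp := rp) ε) (pd e) :=
  angL_commute (pd_commute _ _) (pd_commute _ _) fun _ hg => (pd_angOp_commute he hg).symm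

theorem angL_commute_radOp {ε : ℂ} {f : ℝ → ℝ} (hf : ContDiffOn ℝ (⊤ : ℕ∞) f (Ioi rp)) :
    Commute (angL ε) (radOp f hf) :=
  angL_commute (pd_radOp_commute rfl hf) (pd_radOp_commute rfl hf) fun _ _ => mulOp_commute _ _

theorem Rep.angP {u : F4} {v : SmoothFun rp} (h : Rep u v) : Rep (angP u) (angL 1 v) := by
  intro t r ϑ φ hp
  have hs : Rep (fun t r ϑ φ => (Real.sin ϑ : ℂ) * Grav.dTh u t r ϑ φ)
      (angOp Real.sin Real.contDiff_sin.contDiffOn (pd (0, 0, 1, 0) v)) := fun t r ϑ φ hp => by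
    rw [angOp_apply, ← h.dTh t r ϑ φ hp]
  have hθ := hs.dTh t r ϑ φ hp
  rw [Grav.dTh] at hθ
  rw [Grav.angP, hθ, h.dPh t r ϑ φ hp, h.dPh.dPh t r ϑ φ hp, h t r ϑ φ hp]
  simp [angL, angOp_apply]
  ring

theorem Rep.angM {u : F4} {v : SmoothFun rp} (h : Rep u v) : Rep (angM u) (angL (-1) v) := by
  intro t r ϑ φ hp
  have hs : Rep (fun t r ϑ φ => (Real.sin ϑ : ℂ) * Grav.dTh u t r ϑ φ)
      (angOp Real.sin Real.contDiff_sin.contDiffOn (pd (0, 0, 1, 0) v)) := fun t r ϑ φ hp => by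
    rw [angOp_apply, ← h.dTh t r ϑ φ hp]
  have hθ := hs.dTh t r ϑ φ hp
  rw [Grav.dTh] at hθ
  rw [Grav.angM, hθ, h.dPh t r ϑ φ hp, h.dPh.dPh t r ϑ φ hp, h t r ϑ φ hp]
  simp [angL, angOp_apply]
  ring

/-- `𝓛(𝓛 − 2) + ε 12M∂ₜ` on `SmoothFun rp`. -/
def teukStar (M : ℝ) (ε : ℂ) : Module.End ℂ (SmoothFun rp) :=
  angL ε * (angL ε - 2) + (ε * (12 * M)) • pd (1, 0, 0, 0)

theorem teukStar_commute {M : ℝ} {ε : ℂ} {B : Module.End ℂ (SmoothFun rp)}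
    (h₁ : Commute (angL ε) B) (h₂ : Commute (pd (1, 0, 0, 0)) B) :
    Commute (teukStar M ε) B :=
  (h₁.mul_left (h₁.sub_left (Commute.ofNat_left 2 B))).add_left (h₂.smul_left _)

theorem end_two_apply (v : SmoothFun rp) : (2 : Module.End ℂ (SmoothFun rp)) v = (2 : ℂ) • v := by
  rw [← one_add_one_eq_two, LinearMap.add_apply, Module.End.one_apply, two_smul]

theorem Rep.TSp {u : F4} {v : SmoothFun rp} (M : ℝ) (h : Rep u v) :
    Rep (TSp M u) (teukStar M 1 v) := by
  have h' : Rep (fun t r ϑ φ => Grav.angP u t r ϑ φ - 2 * u t r ϑ φ)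
      ((angL 1 - 2 : Module.End ℂ (SmoothFun rp)) v) :=
    fun t r ϑ φ hp => by
      rw [LinearMap.sub_apply, SmoothFun.sub_val, end_two_apply, SmoothFun.smul_val,
        ← h.angP t r ϑ φ hp, ← h t r ϑ φ hp]
  intro t r ϑ φ hp
  rw [Grav.TSp, angSqP, h'.angP t r ϑ φ hp, h.dT t r ϑ φ hp]
  simp [teukStar]

theorem Rep.TSm {u : F4} {v : SmoothFun rp} (M : ℝ) (h : Rep u v) :
    Rep (TSm M u) (teukStar M (-1) v) := by
  have h' : Rep (fun t r ϑ φ => Grav.angM u t r ϑ φ - 2 * u t r ϑ φ)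
      ((angL (-1) - 2 : Module.End ℂ (SmoothFun rp)) v) :=
    fun t r ϑ φ hp => by
      rw [LinearMap.sub_apply, SmoothFun.sub_val, end_two_apply, SmoothFun.smul_val,
        ← h.angM t r ϑ φ hp, ← h t r ϑ φ hp]
  intro t r ϑ φ hp
  rw [Grav.TSm, angSqM, h'.angM t r ϑ φ hp, h.dT t r ϑ φ hp]
  simp [teukStar, sub_eq_add_neg]

theorem contDiffOn_div_pow (hrp : 0 < rp) {f : ℝ → ℝ} (hf : ContDiff ℝ (⊤ : ℕ∞) f) (n : ℕ) :
    ContDiffOn ℝ (⊤ : ℕ∞) (fun r => f r / r ^ n) (Ioi rp) :=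
  hf.contDiffOn.div (contDiffOn_id.pow n) fun _ hr => pow_ne_zero n (hrp.trans hr).ne'

theorem contDiff_Del (M k : ℝ) : ContDiff ℝ (⊤ : ℕ∞) (Del M k) := by
  unfold Del; fun_prop

theorem Del_pos {M k r : ℝ} (hrp : 0 < rp) (hroot : rp + k ^ 2 * rp ^ 3 - 2 * M = 0)
    (hr : rp < r) : 0 < Del M k r := by
  have h3 : rp ^ 3 ≤ r ^ 3 := pow_le_pow_left₀ hrp.le hr.le 3
  have : 0 < r + k ^ 2 * r ^ 3 - 2 * M := by
    nlinarith [mul_le_mul_of_nonneg_left h3 (sq_nonneg k)]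
  have h : Del M k r = r * (r + k ^ 2 * r ^ 3 - 2 * M) := by unfold Del; ring
  rw [h]
  exact mul_pos (hrp.trans hr) this

theorem ww_ne_zero {M k r : ℝ} (hrp : 0 < rp) (hroot : rp + k ^ 2 * rp ^ 3 - 2 * M = 0)
    (hr : rp < r) : ww M k r ≠ 0 :=
  (div_pos (Del_pos hrp hroot hr) (pow_pos (hrp.trans hr) 4)).ne'

theorem contDiffOn_ww (M k : ℝ) (hrp : 0 < rp) : ContDiffOn ℝ (⊤ : ℕ∞) (ww M k) (Ioi rp) :=
  contDiffOn_div_pow hrp (contDiff_Del M k) 4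

/-- `(Δ/r²)∂ᵣ` on `SmoothFun rp`. -/
def starD (M k : ℝ) (hrp : 0 < rp) : Module.End ℂ (SmoothFun rp) :=
  radOp (fun r => Del M k r / r ^ 2) (contDiffOn_div_pow hrp (contDiff_Del M k) 2) *
    pd (0, 1, 0, 0)

/-- Multiplication by `w` on `SmoothFun rp`. -/
def wOp (M k : ℝ) (hrp : 0 < rp) : Module.End ℂ (SmoothFun rp) :=
  radOp (ww M k) (contDiffOn_ww M k hrp)

/-- Multiplication by `w⁻¹` on `SmoothFun rp`. -/
def wInvOp (M k : ℝ) (hrp : 0 < rp) (hroot : rp + k ^ 2 * rp ^ 3 - 2 * M = 0) :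
    Module.End ℂ (SmoothFun rp) :=
  radOp (fun r => (ww M k r)⁻¹) ((contDiffOn_ww M k hrp).inv fun _ => ww_ne_zero hrp hroot)

/-- Multiplication by `w′/w` on `SmoothFun rp`. -/
def hOp (M : ℝ) (hrp : 0 < rp) : Module.End ℂ (SmoothFun rp) :=
  radOp (fun r => (6 * M - 2 * r) / r ^ 2) (contDiffOn_div_pow hrp (by fun_prop) 2)

/-- Multiplication by `6M/r` on `SmoothFun rp`. -/
def qOp (M : ℝ) (hrp : 0 < rp) : Module.End ℂ (SmoothFun rp) :=
  radOp (fun r => 6 * M / r) (contDiffOn_const.div contDiffOn_id fun _ hr => (hrp.trans hr).ne')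

theorem starD_radOp_apply {M k : ℝ} {hrp : 0 < rp} {f : ℝ → ℝ}
    (hf : ContDiffOn ℝ (⊤ : ℕ∞) f (Ioi rp)) (v : SmoothFun rp) {p : E4} (hp : p ∈ OmSet rp) :
    (starD M k hrp (radOp f hf v)).1 p = (f p.2.1 : ℂ) * (starD M k hrp v).1 p +
      ((Del M k p.2.1 / p.2.1 ^ 2 * deriv f p.2.1 : ℝ) : ℂ) * v.1 p := by
  simp only [starD, Module.End.mul_apply, radOp_apply, pd_radOp_apply _ _ _ hp]
  push_cast
  ring

theorem starD_commute_pd_t {M k : ℝ} {hrp : 0 < rp} :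
    Commute (starD M k hrp) (pd (1, 0, 0, 0)) :=
  (pd_radOp_commute rfl _).symm.mul_left (pd_commute _ _)

theorem starD_wOp {M k : ℝ} {hrp : 0 < rp} :
    starD M k hrp * wOp M k hrp = wOp M k hrp * starD M k hrp + wOp M k hrp * hOp M hrp := by
  refine LinearMap.ext fun v => SmoothFun.ext fun p hp => ?_
  have hr : p.2.1 ≠ 0 := (hrp.trans hp.1).ne'
  have hd : HasDerivAt (ww M k) (-2 / p.2.1 ^ 3 + 6 * M / p.2.1 ^ 4) p.2.1 := by
    have h₁ : HasDerivAt (Del M k) (2 * p.2.1 + k ^ 2 * (4 * p.2.1 ^ 3) - 2 * M) p.2.1 := by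
      simpa [Del] using! (((hasDerivAt_pow 2 p.2.1).add
        ((hasDerivAt_pow 4 p.2.1).const_mul (k ^ 2))).sub
        ((hasDerivAt_id p.2.1).const_mul (2 * M)))
    refine (h₁.div (hasDerivAt_pow 4 p.2.1) (pow_ne_zero 4 hr)).congr_deriv ?_
    simp only [Del]
    field_simp
    push_cast
    ring
  have key : Del M k p.2.1 / p.2.1 ^ 2 * deriv (ww M k) p.2.1 =
      ww M k p.2.1 * ((6 * M - 2 * p.2.1) / p.2.1 ^ 2) := by
    rw [hd.deriv, ww]; field_simp; ring
  simp only [wOp, hOp, Module.End.mul_apply, starD_radOp_apply _ _ hp, LinearMap.add_apply,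
    SmoothFun.add_val, radOp_apply, key]
  push_cast
  ring

theorem starD_hOp {M k : ℝ} {hrp : 0 < rp} :
    starD M k hrp * hOp M hrp =
      hOp M hrp * starD M k hrp + wOp M k hrp * (2 - 2 * qOp M hrp) := by
  refine LinearMap.ext fun v => SmoothFun.ext fun p hp => ?_
  have hr : p.2.1 ≠ 0 := (hrp.trans hp.1).ne'
  have hd : HasDerivAt (fun r : ℝ => (6 * M - 2 * r) / r ^ 2)
      (2 / p.2.1 ^ 2 - 12 * M / p.2.1 ^ 3) p.2.1 := by
    refine ((((hasDerivAt_id p.2.1).const_mul 2).const_sub (6 * M)).div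
      (hasDerivAt_pow 2 p.2.1) (pow_ne_zero 2 hr)).congr_deriv ?_
    simp only [id]
    field_simp
    push_cast
    ring
  have key : Del M k p.2.1 / p.2.1 ^ 2 * deriv (fun r : ℝ => (6 * M - 2 * r) / r ^ 2) p.2.1 =
      ww M k p.2.1 * (2 - 2 * (6 * M / p.2.1)) := by
    rw [hd.deriv, ww]; field_simp; ring
  simp only [wOp, hOp, qOp, Module.End.mul_apply, starD_radOp_apply _ _ hp, LinearMap.add_apply,
    LinearMap.sub_apply, SmoothFun.add_val, SmoothFun.sub_val, SmoothFun.smul_val,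
    end_two_apply, radOp_apply, key]
  push_cast
  ring

theorem starD_qOp {M k : ℝ} {hrp : 0 < rp} :
    starD M k hrp * qOp M hrp =
      qOp M hrp * starD M k hrp - algebraMap ℂ _ (6 * M) * wOp M k hrp := by
  refine LinearMap.ext fun v => SmoothFun.ext fun p hp => ?_
  have hr : p.2.1 ≠ 0 := (hrp.trans hp.1).ne'
  have hd : HasDerivAt (fun r : ℝ => 6 * M / r) (-(6 * M) / p.2.1 ^ 2) p.2.1 := by
    refine ((hasDerivAt_const p.2.1 (6 * M)).div (hasDerivAt_id p.2.1) hr).congr_deriv ?_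
    simp
  have key : Del M k p.2.1 / p.2.1 ^ 2 * deriv (fun r : ℝ => 6 * M / r) p.2.1 =
      -(6 * M * ww M k p.2.1) := by
    rw [hd.deriv, ww]; field_simp
  simp only [wOp, qOp, Module.End.mul_apply, starD_radOp_apply _ _ hp, LinearMap.sub_apply,
    SmoothFun.sub_val, SmoothFun.smul_val,
    Module.algebraMap_end_apply, radOp_apply, key]
  push_cast
  ring

theorem wOp_mul_wInvOp {M k : ℝ} {hrp : 0 < rp} {hroot : rp + k ^ 2 * rp ^ 3 - 2 * M = 0} :
    wOp M k hrp * wInvOp M k hrp hroot = 1 :=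
  LinearMap.ext fun v => SmoothFun.ext fun p hp => by
    have := ww_ne_zero (M := M) (k := k) hrp hroot hp.1
    simp [wOp, wInvOp, radOp_apply, this]

theorem Rep.winv {M k : ℝ} {u : F4} {v : SmoothFun rp} (hrp : 0 < rp)
    (hroot : rp + k ^ 2 * rp ^ 3 - 2 * M = 0) (h : Rep u v) :
    Rep (winv M k u) (wInvOp M k hrp hroot v) := fun t r ϑ φ hp => by
  simp [Grav.winv, wInvOp, radOp_apply, h t r ϑ φ hp]

theorem Rep.wmul {M k : ℝ} {u : F4} {v : SmoothFun rp} (hrp : 0 < rp) (h : Rep u v) :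
    Rep (wmul M k u) (wOp M k hrp v) := fun t r ϑ φ hp => by
  simp [Grav.wmul, wOp, radOp_apply, h t r ϑ φ hp]

theorem Rep.opL {M k : ℝ} {u : F4} {v : SmoothFun rp} (hrp : 0 < rp) (h : Rep u v) :
    Rep (opL M k u) ((pd (1, 0, 0, 0) + starD M k hrp : Module.End ℂ (SmoothFun rp)) v) :=
  fun t r ϑ φ hp => by
    simp [Grav.opL, starD, radOp_apply, h.dT t r ϑ φ hp, h.dR t r ϑ φ hp]

theorem Rep.opLb {M k : ℝ} {u : F4} {v : SmoothFun rp} (hrp : 0 < rp) (h : Rep u v) :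
    Rep (opLb M k u) ((pd (1, 0, 0, 0) - starD M k hrp : Module.End ℂ (SmoothFun rp)) v) :=
  fun t r ϑ φ hp => by
    simp [Grav.opLb, starD, radOp_apply, h.dT t r ϑ φ hp, h.dR t r ϑ φ hp]

theorem wInvOp_mul_wOp {M k : ℝ} {hrp : 0 < rp} {hroot : rp + k ^ 2 * rp ^ 3 - 2 * M = 0} :
    wInvOp M k hrp hroot * wOp M k hrp = 1 :=
  LinearMap.ext fun v => SmoothFun.ext fun p hp => by
    have := ww_ne_zero (M := M) (k := k) hrp hroot hp.1
    simp [wOp, wInvOp, radOp_apply, this]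

theorem angL_commute_starD {M k : ℝ} {hrp : 0 < rp} {ε : ℂ} :
    Commute (angL ε) (starD M k hrp) :=
  (angL_commute_radOp _).mul_right (angL_commute_pd rfl)

theorem wwP_div_ww {M k r : ℝ} (hw : ww M k r ≠ 0) :
    wwP M k r / ww M k r = (6 * M - 2 * r) / r ^ 2 := by
  rw [wwP, mul_div_assoc, mul_div_cancel_left₀ _ hw]

theorem L_mul_Lb {M k : ℝ} {hrp : 0 < rp} :
    (pd (1, 0, 0, 0) + -starD M k hrp) * (pd (1, 0, 0, 0) - -starD M k hrp) =
      (pd (1, 0, 0, 0) + starD M k hrp) * (pd (1, 0, 0, 0) - starD M k hrp) := by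
  simp only [add_mul, mul_sub, mul_neg, neg_mul,
    (starD_commute_pd_t (M := M) (k := k) (hrp := hrp)).eq]
  abel

theorem Rep.RWp {M k : ℝ} {u : F4} {v : SmoothFun rp} (hrp : 0 < rp) (h : Rep u v) :
    Rep (RWp M k u)
      ((-((pd (1, 0, 0, 0) + starD M k hrp) * (pd (1, 0, 0, 0) - starD M k hrp))
        - wOp M k hrp * (angL 1 - qOp M hrp) : Module.End ℂ (SmoothFun rp)) v) := by
  intro t r ϑ φ hp
  rw [Grav.RWp, (h.opLb hrp).opL hrp t r ϑ φ hp, h.angP t r ϑ φ hp, h t r ϑ φ hp]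
  rfl

theorem Rep.RWm {M k : ℝ} {u : F4} {v : SmoothFun rp} (hrp : 0 < rp) (h : Rep u v) :
    Rep (RWm M k u)
      ((-((pd (1, 0, 0, 0) + -starD M k hrp) * (pd (1, 0, 0, 0) - -starD M k hrp))
        - wOp M k hrp * (angL (-1) - qOp M hrp) : Module.End ℂ (SmoothFun rp)) v) := by
  intro t r ϑ φ hp
  rw [L_mul_Lb, Grav.RWm, (h.opLb hrp).opL hrp t r ϑ φ hp, h.angM t r ϑ φ hp, h t r ϑ φ hp]
  rfl

theorem Rep.Tp {M k : ℝ} {u : F4} {v : SmoothFun rp} (hrp : 0 < rp)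
    (hroot : rp + k ^ 2 * rp ^ 3 - 2 * M = 0) (h : Rep u v) :
    Rep (Tp M k u)
      ((-((pd (1, 0, 0, 0) + starD M k hrp) * (pd (1, 0, 0, 0) - starD M k hrp))
        + 2 * hOp M hrp * (pd (1, 0, 0, 0) - starD M k hrp)
        - wOp M k hrp * (angL 1 - 2 + qOp M hrp) : Module.End ℂ (SmoothFun rp)) v) := by
  intro t r ϑ φ hp
  rw [Grav.Tp, wwP_div_ww (ww_ne_zero hrp hroot hp.1), (h.opLb hrp).opL hrp t r ϑ φ hp,
    h.opLb hrp t r ϑ φ hp, h.angP t r ϑ φ hp, h t r ϑ φ hp, mul_assoc 2, mul_assoc 2]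
  simp only [LinearMap.sub_apply, LinearMap.add_apply, LinearMap.neg_apply, Module.End.mul_apply,
    end_two_apply, SmoothFun.sub_val, SmoothFun.add_val, SmoothFun.neg_val, SmoothFun.smul_val,
    hOp, wOp, qOp, radOp_apply]

theorem Rep.Tm {M k : ℝ} {u : F4} {v : SmoothFun rp} (hrp : 0 < rp)
    (hroot : rp + k ^ 2 * rp ^ 3 - 2 * M = 0) (h : Rep u v) :
    Rep (Tm M k u)
      ((-((pd (1, 0, 0, 0) + -starD M k hrp) * (pd (1, 0, 0, 0) - -starD M k hrp))
        + 2 * -hOp M hrp * (pd (1, 0, 0, 0) - -starD M k hrp)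
        - wOp M k hrp * (angL (-1) - 2 + qOp M hrp) : Module.End ℂ (SmoothFun rp)) v) := by
  intro t r ϑ φ hp
  rw [L_mul_Lb, sub_neg_eq_add, Grav.Tm, wwP_div_ww (ww_ne_zero hrp hroot hp.1),
    (h.opLb hrp).opL hrp t r ϑ φ hp, h.opL hrp t r ϑ φ hp, h.angM t r ϑ φ hp, h t r ϑ φ hp,
    mul_assoc 2, mul_assoc 2]
  simp only [LinearMap.sub_apply, LinearMap.add_apply, LinearMap.neg_apply, Module.End.mul_apply,
    end_two_apply, SmoothFun.sub_val, SmoothFun.add_val, SmoothFun.neg_val, SmoothFun.smul_val,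
    hOp, wOp, qOp, radOp_apply]
  ring

theorem Rep.reverse_plus {M k : ℝ} {u : F4} {v : SmoothFun rp} (hrp : 0 < rp)
    (hroot : rp + k ^ 2 * rp ^ 3 - 2 * M = 0) (h : Rep u v) :
    Rep (fun t r ϑ φ => (((ww M k r) ^ 2 : ℝ) : ℂ) *
        Grav.TSp M (Grav.winv M k (Grav.opL M k (Grav.winv M k (Grav.opL M k u)))) t r ϑ φ)
      ((wOp M k hrp * wOp M k hrp * (teukStar M 1 * (wInvOp M k hrp hroot *
        ((pd (1, 0, 0, 0) + starD M k hrp) * (wInvOp M k hrp hroot *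
          (pd (1, 0, 0, 0) + starD M k hrp))))) : Module.End ℂ (SmoothFun rp)) v) := by
  intro t r ϑ φ hp
  beta_reduce
  rw [((((h.opL hrp).winv hrp hroot).opL hrp).winv hrp hroot).TSp M t r ϑ φ hp, sq,
    Complex.ofReal_mul, mul_assoc]
  rfl

theorem Rep.reverse_minus {M k : ℝ} {u : F4} {v : SmoothFun rp} (hrp : 0 < rp)
    (hroot : rp + k ^ 2 * rp ^ 3 - 2 * M = 0) (h : Rep u v) :
    Rep (fun t r ϑ φ => (((ww M k r) ^ 2 : ℝ) : ℂ) *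
        Grav.TSm M (Grav.winv M k (Grav.opLb M k (Grav.winv M k (Grav.opLb M k u)))) t r ϑ φ)
      ((wOp M k hrp * wOp M k hrp * (teukStar M (-1) * (wInvOp M k hrp hroot *
        ((pd (1, 0, 0, 0) + -starD M k hrp) * (wInvOp M k hrp hroot *
          (pd (1, 0, 0, 0) + -starD M k hrp))))) : Module.End ℂ (SmoothFun rp)) v) := by
  intro t r ϑ φ hp
  beta_reduce
  rw [((((h.opLb hrp).winv hrp hroot).opLb hrp).winv hrp hroot).TSm M t r ϑ φ hp, sq,
    Complex.ofReal_mul, mul_assoc, ← sub_eq_add_neg]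
  rfl

theorem Rep.source_plus {M k : ℝ} {u : F4} {v : SmoothFun rp} (hrp : 0 < rp)
    (hroot : rp + k ^ 2 * rp ^ 3 - 2 * M = 0) (h : Rep u v) :
    Rep (fun t r ϑ φ =>
        Grav.opL M k (Grav.wmul M k (Grav.opL M k (Grav.winv M k u))) t r ϑ φ
          - 2 * ((wwP M k r : ℝ) : ℂ) * Grav.opL M k (Grav.winv M k u) t r ϑ φ)
      (((pd (1, 0, 0, 0) + starD M k hrp) * (wOp M k hrp * ((pd (1, 0, 0, 0) + starD M k hrp) *
          wInvOp M k hrp hroot))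
        - 2 * (wOp M k hrp * hOp M hrp) * ((pd (1, 0, 0, 0) + starD M k hrp) *
          wInvOp M k hrp hroot) : Module.End ℂ (SmoothFun rp)) v) := by
  intro t r ϑ φ hp
  beta_reduce
  rw [(((h.winv hrp hroot).opL hrp).wmul hrp).opL hrp t r ϑ φ hp,
    (h.winv hrp hroot).opL hrp t r ϑ φ hp, wwP, mul_div_assoc, Complex.ofReal_mul, mul_assoc 2,
    mul_assoc 2, mul_assoc]
  simp only [LinearMap.sub_apply, Module.End.mul_apply, end_two_apply, SmoothFun.sub_val,
    SmoothFun.smul_val]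
  rfl

theorem Rep.source_minus {M k : ℝ} {u : F4} {v : SmoothFun rp} (hrp : 0 < rp)
    (hroot : rp + k ^ 2 * rp ^ 3 - 2 * M = 0) (h : Rep u v) :
    Rep (fun t r ϑ φ =>
        Grav.opLb M k (Grav.wmul M k (Grav.opLb M k (Grav.winv M k u))) t r ϑ φ
          + 2 * ((wwP M k r : ℝ) : ℂ) * Grav.opLb M k (Grav.winv M k u) t r ϑ φ)
      (((pd (1, 0, 0, 0) + -starD M k hrp) * (wOp M k hrp * ((pd (1, 0, 0, 0) + -starD M k hrp) *
          wInvOp M k hrp hroot))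
        - 2 * (wOp M k hrp * -hOp M hrp) * ((pd (1, 0, 0, 0) + -starD M k hrp) *
          wInvOp M k hrp hroot) : Module.End ℂ (SmoothFun rp)) v) := by
  intro t r ϑ φ hp
  beta_reduce
  rw [(((h.winv hrp hroot).opLb hrp).wmul hrp).opLb hrp t r ϑ φ hp,
    (h.winv hrp hroot).opLb hrp t r ϑ φ hp, wwP, mul_div_assoc, Complex.ofReal_mul, mul_assoc 2,
    mul_assoc 2, mul_assoc, ← sub_eq_add_neg, mul_neg, neg_mul, mul_neg, sub_neg_eq_add]
  simp only [LinearMap.add_apply, Module.End.mul_apply, end_two_apply, SmoothFun.add_val,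
    SmoothFun.smul_val]
  rfl

theorem teukolsky_reverse_plus {M k : ℝ} (hrp : 0 < rp)
    (hroot : rp + k ^ 2 * rp ^ 3 - 2 * M = 0) {u g : F4} {v f : SmoothFun rp} (hu : Rep u v)
    (hg : Rep g f)
    (hRW : ∀ t r ϑ φ : ℝ, (t, r, ϑ, φ) ∈ OmSet rp → RWp M k u t r ϑ φ = g t r ϑ φ) :
    Rep (Tp M k (fun t r ϑ φ => (((ww M k r) ^ 2 : ℝ) : ℂ) *
        TSp M (winv M k (opL M k (winv M k (opL M k u)))) t r ϑ φ))
      (teukStar M 1 (((pd (1, 0, 0, 0) + starD M k hrp) *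
          (wOp M k hrp * ((pd (1, 0, 0, 0) + starD M k hrp) * wInvOp M k hrp hroot))
        - 2 * (wOp M k hrp * hOp M hrp) * ((pd (1, 0, 0, 0) + starD M k hrp) *
          wInvOp M k hrp hroot) : Module.End ℂ (SmoothFun rp)) f)) := by
  have key := LinearMap.congr_fun (teukolsky_reggeWheeler_identity
    (T := pd (1, 0, 0, 0)) (X := starD M k hrp) (w := wOp M k hrp) (wi := wInvOp M k hrp hroot)
    (h := hOp M hrp) (q := qOp M hrp) (c := algebraMap ℂ _ (6 * M)) (A := angL 1)
    (S := teukStar M 1) wOp_mul_wInvOp wInvOp_mul_wOp (radOp_commute _ _) (radOp_commute _ _)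
    (radOp_commute _ _) (Algebra.commutes _ _) (Algebra.commutes _ _).symm
    (Algebra.commutes _ _).symm (pd_radOp_commute rfl _) (pd_radOp_commute rfl _)
    (pd_radOp_commute rfl _) starD_commute_pd_t starD_wOp starD_hOp starD_qOp
    (angL_commute_pd rfl) angL_commute_starD (angL_commute_radOp _) (angL_commute_radOp _)
    (teukStar_commute (angL_commute_pd rfl) (Commute.refl _))
    (teukStar_commute angL_commute_starD starD_commute_pd_t.symm)
    (teukStar_commute (angL_commute_radOp _) (pd_radOp_commute rfl _))
    (teukStar_commute (angL_commute_radOp _) (pd_radOp_commute rfl _))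
    (teukStar_commute (angL_commute_radOp _) (pd_radOp_commute rfl _))
    (teukStar_commute (Commute.refl _) (angL_commute_pd rfl).symm)) v
  rw [← (hu.RWp hrp).unique hg hRW]
  exact key ▸ (hu.reverse_plus hrp hroot).Tp hrp hroot

theorem teukolsky_reverse_minus {M k : ℝ} (hrp : 0 < rp)
    (hroot : rp + k ^ 2 * rp ^ 3 - 2 * M = 0) {u g : F4} {v f : SmoothFun rp} (hu : Rep u v)
    (hg : Rep g f)
    (hRW : ∀ t r ϑ φ : ℝ, (t, r, ϑ, φ) ∈ OmSet rp → RWm M k u t r ϑ φ = g t r ϑ φ) :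
    Rep (Tm M k (fun t r ϑ φ => (((ww M k r) ^ 2 : ℝ) : ℂ) *
        TSm M (winv M k (opLb M k (winv M k (opLb M k u)))) t r ϑ φ))
      (teukStar M (-1) (((pd (1, 0, 0, 0) + -starD M k hrp) *
          (wOp M k hrp * ((pd (1, 0, 0, 0) + -starD M k hrp) * wInvOp M k hrp hroot))
        - 2 * (wOp M k hrp * -hOp M hrp) * ((pd (1, 0, 0, 0) + -starD M k hrp) *
          wInvOp M k hrp hroot) : Module.End ℂ (SmoothFun rp)) f)) := by
  have key := LinearMap.congr_fun (teukolsky_reggeWheeler_identity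
    (T := pd (1, 0, 0, 0)) (X := -starD M k hrp) (w := wOp M k hrp) (wi := wInvOp M k hrp hroot)
    (h := -hOp M hrp) (q := qOp M hrp) (c := -algebraMap ℂ _ (6 * M)) (A := angL (-1))
    (S := teukStar M (-1)) wOp_mul_wInvOp wInvOp_mul_wOp
    (Commute.neg_left (radOp_commute _ _)) (radOp_commute _ _)
    (Commute.neg_right (radOp_commute _ _)) (Commute.neg_left (Algebra.commutes _ _))
    (Commute.neg_right (Algebra.commutes _ _).symm)
    (Commute.neg_right (Algebra.commutes _ _).symm) (pd_radOp_commute rfl _)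
    (pd_radOp_commute rfl _).neg_right
    (pd_radOp_commute rfl _) starD_commute_pd_t.neg_left
    (by rw [neg_mul, starD_wOp, neg_add, mul_neg, mul_neg])
    (by rw [neg_mul_neg, starD_hOp, neg_mul_neg])
    (by rw [neg_mul, starD_qOp, neg_sub, mul_neg, neg_mul]; abel)
    (angL_commute_pd rfl) angL_commute_starD.neg_right (angL_commute_radOp _)
    (angL_commute_radOp _).neg_right
    (teukStar_commute (angL_commute_pd rfl) (Commute.refl _))
    (teukStar_commute angL_commute_starD starD_commute_pd_t.symm).neg_right
    (teukStar_commute (angL_commute_radOp _) (pd_radOp_commute rfl _))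
    (teukStar_commute (angL_commute_radOp _) (pd_radOp_commute rfl _)).neg_right
    (teukStar_commute (angL_commute_radOp _) (pd_radOp_commute rfl _))
    (teukStar_commute (Commute.refl _) (angL_commute_pd rfl).symm)) v
  rw [← (hu.RWm hrp).unique hg hRW]
  exact key ▸ (hu.reverse_minus hrp hroot).Tm hrp hroot

/-- The reverse Chandrasekhar transformations of solutions of the
inhomogeneous Regge–Wheeler equations satisfy inhomogeneous Teukolsky equations;
in particular if `F⁽±²⁾ = 0` then `𝔗⁽±²⁾α̃⁽±²ʳ⁾ = 0`. -/
theorem statement6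
    (M k rp : ℝ) (hM : 0 < M) (hk : 0 < k) (hrp : 0 < rp)
    (hroot : rp + k ^ 2 * rp ^ 3 - 2 * M = 0)
    (Ψp Ψm Fp Fm : F4)
    (hΨp : SmoothOnOm rp Ψp) (hΨm : SmoothOnOm rp Ψm)
    (hFp : SmoothOnOm rp Fp) (hFm : SmoothOnOm rp Fm)
    (hRWp : ∀ t r ϑ φ : ℝ, (t, r, ϑ, φ) ∈ OmSet rp → RWp M k Ψp t r ϑ φ = Fp t r ϑ φ)
    (hRWm : ∀ t r ϑ φ : ℝ, (t, r, ϑ, φ) ∈ OmSet rp → RWm M k Ψm t r ϑ φ = Fm t r ϑ φ)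
    (ψpr αpr ψmr αmr : F4)
    (hψpr : ψpr = winv M k (opL M k Ψp))
    (hαpr : αpr = fun t r ϑ φ =>
      (((ww M k r) ^ 2 : ℝ) : ℂ) * TSp M (winv M k (opL M k ψpr)) t r ϑ φ)
    (hψmr : ψmr = winv M k (opLb M k Ψm))
    (hαmr : αmr = fun t r ϑ φ =>
      (((ww M k r) ^ 2 : ℝ) : ℂ) * TSm M (winv M k (opLb M k ψmr)) t r ϑ φ) :
    (∀ t r ϑ φ : ℝ, (t, r, ϑ, φ) ∈ OmSet rp →
      Tp M k αpr t r ϑ φ =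
        TSp M (fun t r ϑ φ =>
          opL M k (wmul M k (opL M k (winv M k Fp))) t r ϑ φ
            - 2 * ((wwP M k r : ℝ) : ℂ) * opL M k (winv M k Fp) t r ϑ φ) t r ϑ φ
      ∧
      Tm M k αmr t r ϑ φ =
        TSm M (fun t r ϑ φ =>
          opLb M k (wmul M k (opLb M k (winv M k Fm))) t r ϑ φ
            + 2 * ((wwP M k r : ℝ) : ℂ) * opLb M k (winv M k Fm) t r ϑ φ) t r ϑ φ)
    ∧
    ((∀ t r ϑ φ : ℝ, (t, r, ϑ, φ) ∈ OmSet rp → Fp t r ϑ φ = 0 ∧ Fm t r ϑ φ = 0) →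
      ∀ t r ϑ φ : ℝ, (t, r, ϑ, φ) ∈ OmSet rp →
        Tp M k αpr t r ϑ φ = 0 ∧ Tm M k αmr t r ϑ φ = 0) := by
  subst hψpr hαpr hψmr hαmr
  obtain ⟨vp, hvp⟩ := exists_rep hΨp
  obtain ⟨vm, hvm⟩ := exists_rep hΨm
  obtain ⟨fp, hfp⟩ := exists_rep hFp
  obtain ⟨fm, hfm⟩ := exists_rep hFm
  have hp := teukolsky_reverse_plus hrp hroot hvp hfp hRWp
  have hm := teukolsky_reverse_minus hrp hroot hvm hfm hRWm
  refine ⟨fun t r ϑ φ hx => ⟨?_, ?_⟩, fun h0 t r ϑ φ hx => ⟨?_, ?_⟩⟩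
  · rw [hp t r ϑ φ hx, (hfp.source_plus hrp hroot).TSp M t r ϑ φ hx]
  · rw [hm t r ϑ φ hx, (hfm.source_minus hrp hroot).TSm M t r ϑ φ hx]
  · have hf : fp = 0 := hfp.unique (u' := fun _ _ _ _ => 0) (fun _ _ _ _ _ => rfl)
      fun t r ϑ φ hx => (h0 t r ϑ φ hx).1
    rw [hp t r ϑ φ hx, hf, map_zero, map_zero, SmoothFun.zero_val]
  · have hf : fm = 0 := hfm.unique (u' := fun _ _ _ _ => 0) (fun _ _ _ _ _ => rfl)
      fun t r ϑ φ hx => (h0 t r ϑ φ hx).2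
    rw [hm t r ϑ φ hx, hf, map_zero, map_zero, SmoothFun.zero_val]

end Grav
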